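/- There exist an open set V with Δ ⊆ V ⊆ W and ε > 0 such that for every twice continuously ℝ-differentiable u : ℂ^n → ℝ with ‖u − φ‖_{C²} < ε: (i) ℒ_{φ,V}(u)(w) is finite for every w ∈ ℂ^n; and (ii) ℒ_{φ,V}(u) = u if and only if u = φ. -/

import Mathlib

open scoped ComplexConjugate

noncomputable section

/-- The j-th standard basis vector of ℂⁿ. -/
def ej {n : ℕ} (j : Fin n) : EuclideanSpace ℂ (Fin n) := EuclideanSpace.single j 1

/-- Second real (Fréchet) derivative of f evaluated on a pair of directions. -/
def D2 {n : ℕ} (f : EuclideanSpace ℂ (Fin n) → ℝ) (z v w : EuclideanSpace ℂ (Fin n)) : ℝ :=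
  fderiv ℝ (fderiv ℝ f) z v w

/-- The complex Hessian H_f(z)_{jk} = (∂²f/∂z_j∂z̄_k)(z). -/
def cHess {n : ℕ} (f : EuclideanSpace ℂ (Fin n) → ℝ) (z : EuclideanSpace ℂ (Fin n))
    (j k : Fin n) : ℂ :=
  (1 / 4 : ℂ) *
    (↑(D2 f z (ej j) (ej k) + D2 f z (Complex.I • ej j) (Complex.I • ej k))
      + Complex.I * ↑(D2 f z (ej j) (Complex.I • ej k) - D2 f z (Complex.I • ej j) (ej k)))

/-- `f` is strongly plurisubharmonic: Σ_{j,k} H_f(z)_{jk}·a_j·conj(a_k) ≥ c·‖a‖² for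
some c > 0 and all z, a. -/
def StronglyPsh {n : ℕ} (f : EuclideanSpace ℂ (Fin n) → ℝ) : Prop :=
  ∃ c > (0 : ℝ), ∀ z a : EuclideanSpace ℂ (Fin n),
    c * ‖a‖ ^ 2 ≤ (∑ j, ∑ k, cHess f z j k * a j * conj (a k)).re

/-- `F` is a polarization of `φ` on `W ⊆ ℂⁿ × ℂⁿ` containing the diagonal. -/
def IsPolarization {n : ℕ} (φ : EuclideanSpace ℂ (Fin n) → ℝ)
    (W : Set (EuclideanSpace ℂ (Fin n) × EuclideanSpace ℂ (Fin n)))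
    (F : EuclideanSpace ℂ (Fin n) × EuclideanSpace ℂ (Fin n) → ℂ) : Prop :=
  (∀ w, DifferentiableOn ℂ (fun z => F (z, w)) {z | (z, w) ∈ W}) ∧
  (∀ z, DifferentiableOn ℂ (fun w => conj (F (z, w))) {w | (z, w) ∈ W}) ∧
  (∀ p, F (p, p) = (φ p : ℂ))

/-- The φ-Legendre transform (w.r.t. the polarization F and the set V):
ℒ_{φ,V}(u)(w) = sup {2·Re F(z,w) − u(z) : (z,w) ∈ V} ∈ ℝ ∪ {+∞}. -/
def Leg {n : ℕ} (F : EuclideanSpace ℂ (Fin n) × EuclideanSpace ℂ (Fin n) → ℂ)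
    (V : Set (EuclideanSpace ℂ (Fin n) × EuclideanSpace ℂ (Fin n)))
    (u : EuclideanSpace ℂ (Fin n) → ℝ) (w : EuclideanSpace ℂ (Fin n)) : EReal :=
  ⨆ z ∈ {z : EuclideanSpace ℂ (Fin n) | (z, w) ∈ V},
    ((2 * (F (z, w)).re - u z : ℝ) : EReal)

/-- `‖u − φ‖_{C²} < ε`, where `‖v‖_{C²} = sup_z (|v(z)| + ‖Dv(z)‖ + ‖D²v(z)‖)` (real
Fréchet derivatives). -/
def C2Close {n : ℕ} (u φ : EuclideanSpace ℂ (Fin n) → ℝ) (ε : ℝ) : Prop :=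
  ∀ z : EuclideanSpace ℂ (Fin n),
    |u z - φ z| + ‖fderiv ℝ (fun x => u x - φ x) z‖
      + ‖fderiv ℝ (fderiv ℝ (fun x => u x - φ x)) z‖ < ε

/-- The supremum defining ℒ_{φ,V}(u)(w) is attained at z:
(z,w) ∈ V and 2·Re F(z,w) − u(z) is maximal among admissible points. -/
def AttainsAt {n : ℕ} (F : EuclideanSpace ℂ (Fin n) × EuclideanSpace ℂ (Fin n) → ℂ)
    (V : Set (EuclideanSpace ℂ (Fin n) × EuclideanSpace ℂ (Fin n)))
    (u : EuclideanSpace ℂ (Fin n) → ℝ) (w z : EuclideanSpace ℂ (Fin n)) : Prop :=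
  (z, w) ∈ V ∧ ∀ z', (z', w) ∈ V →
    2 * (F (z', w)).re - u z' ≤ 2 * (F (z, w)).re - u z

open Metric Set Filter Topology

lemma lip_of_bdd {f : ℂ → ℂ} {c : ℂ} {ρ M : ℝ} (hd : DifferentiableOn ℂ f (ball c ρ))
    (hM : ∀ z ∈ ball c ρ, ‖f z‖ ≤ M) {z : ℂ} (hz : z ∈ ball c ρ) :
    ‖f z - f c‖ ≤ (2 * M / ρ) * ‖z - c‖ := by
  have hc : c ∈ ball c ρ := mem_ball_self (pos_of_mem_ball hz)
  have := Complex.dist_le_div_mul_dist_of_mapsTo_ball (R₂ := 2 * M) hd ?_ hz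
  · simpa [dist_eq_norm] using this
  · intro y hy
    rw [mem_closedBall, dist_eq_norm]
    have h1 := hM y hy
    have h2 := hM c hc
    have := norm_sub_le (f y) (f c)
    linarith

lemma osgood_diag {g : ℂ → ℂ → ℂ} {c : ℂ} {ρ M : ℝ} (hρ : 0 < ρ)
    (h1 : ∀ t ∈ ball c ρ, DifferentiableOn ℂ (fun s => g s t) (ball c ρ))
    (h2 : ∀ s ∈ ball c ρ, DifferentiableOn ℂ (fun t => g s t) (ball c ρ))
    (hM : ∀ s ∈ ball c ρ, ∀ t ∈ ball c ρ, ‖g s t‖ ≤ M) :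
    DifferentiableAt ℂ (fun τ => g τ τ) c := by
  have hc : c ∈ ball c ρ := mem_ball_self hρ
  have key : ∀ τ ∈ ball c ρ, ‖g τ τ - g τ c - g c τ + g c c‖
      ≤ (4 * M / ρ ^ 2) * ‖τ - c‖ ^ 2 := by
    intro τ hτ
    have := lip_of_bdd (f := fun s => g s τ - g s c) (M := (2 * M / ρ) * ‖τ - c‖)
      ((h1 τ hτ).sub (h1 c hc)) (fun s hs => lip_of_bdd (h2 s hs) (hM s hs) hτ) hτ
    calc _ = ‖g τ τ - g τ c - (g c τ - g c c)‖ := by congr 1; ring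
      _ ≤ _ := this
      _ = _ := by field_simp; ring
  have hO : (fun τ => g τ τ - g τ c - g c τ + g c c) =o[𝓝 c] (fun τ => τ - c) := by
    have : (fun τ => g τ τ - g τ c - g c τ + g c c) =O[𝓝 c] (fun τ => ‖τ - c‖ ^ 2) := by
      apply Asymptotics.IsBigO.of_bound (4 * M / ρ ^ 2)
      filter_upwards [ball_mem_nhds c hρ] with τ hτ
      simpa using key τ hτ
    refine this.trans_isLittleO ?_
    have h := Asymptotics.isLittleO_pow_sub_sub c (m := 2) (by norm_num)
    simpa using h.norm_left
  have hd : HasDerivAt (fun τ => g τ τ - g τ c - g c τ + g c c) 0 c := by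
    rw [hasDerivAt_iff_isLittleO]
    simpa using hO
  have e1 := (h1 c hc).differentiableAt (ball_mem_nhds c hρ)
  have e2 := (h2 c hc).differentiableAt (ball_mem_nhds c hρ)
  have := ((hd.differentiableAt.add e1).add e2).sub (differentiableAt_const (g c c))
  refine this.congr_of_eventuallyEq (Eventually.of_forall fun τ => ?_)
  simp
  ring

lemma zero_on_convex {E : Type*} [NormedAddCommGroup E] [NormedSpace ℂ E] {B : Set E}
    (hB : IsOpen B) (hcv : Convex ℝ B) {g : E → ℂ} (hg : DifferentiableOn ℂ g B)
    {q : E} (hq : q ∈ B) (h0 : ∀ᶠ x in 𝓝 q, g x = 0) : ∀ x ∈ B, g x = 0 := by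
  intro x hx
  set ℓ : ℂ → E := fun t => q + t • (x - q) with hℓ
  have hℓd : Differentiable ℂ ℓ := by fun_prop
  set U := ℓ ⁻¹' B
  have hUo : IsOpen U := hB.preimage hℓd.continuous
  have hUc : Convex ℝ U := by
    intro a ha b hb s t hs ht hst
    have : ℓ (s • a + t • b) = s • ℓ a + t • ℓ b := by
      simp only [hℓ]
      have e : q = s • q + t • q := by rw [← add_smul, hst, one_smul]
      nth_rw 1 [e]
      simp only [add_smul, smul_add, smul_assoc]
      abel
    change ℓ _ ∈ B
    rw [this]
    exact hcv ha hb hs ht hst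
  have hf : AnalyticOnNhd ℂ (g ∘ ℓ) U :=
    (hg.comp hℓd.differentiableOn (fun t ht => ht)).analyticOnNhd hUo
  have h0U : (0:ℂ) ∈ U := by simpa [U, hℓ] using hq
  have h1U : (1:ℂ) ∈ U := by simpa [U, hℓ] using hx
  have hz : (g ∘ ℓ) =ᶠ[𝓝 0] 0 := by
    have : Tendsto ℓ (𝓝 0) (𝓝 q) := by
      have := hℓd.continuous.tendsto 0
      simpa [hℓ] using this
    exact this.eventually h0
  have := hf.eqOn_zero_of_preconnected_of_eventuallyEq_zero hUc.isPreconnected h0U hz h1U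
  simpa [hℓ] using this

/-- Coordinatewise complex conjugation. -/
def cj {n : ℕ} : EuclideanSpace ℂ (Fin n) →L[ℝ] EuclideanSpace ℂ (Fin n) :=
  LinearMap.toContinuousLinearMap
    { toFun := fun x => WithLp.toLp 2 (fun i => conj (x i))
      map_add' := fun x y => by ext i; simp
      map_smul' := fun c x => by ext i; simp }

@[simp] lemma cj_apply {n : ℕ} (x : EuclideanSpace ℂ (Fin n)) (i : Fin n) :
    cj x i = conj (x i) := rfl

@[simp] lemma cj_cj {n : ℕ} (x : EuclideanSpace ℂ (Fin n)) : cj (cj x) = x := by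
  ext i; simp

lemma cj_smul {n : ℕ} (c : ℂ) (x : EuclideanSpace ℂ (Fin n)) : cj (c • x) = conj c • cj x := by
  ext i; simp

@[simp] lemma norm_cj {n : ℕ} (x : EuclideanSpace ℂ (Fin n)) : ‖cj x‖ = ‖x‖ := by
  simp [EuclideanSpace.norm_eq]

lemma line_zero {n : ℕ} {H : EuclideanSpace ℂ (Fin n) → EuclideanSpace ℂ (Fin n) → ℂ}
    {q : EuclideanSpace ℂ (Fin n)} {δ M : ℝ}
    (h1 : ∀ ω ∈ ball (cj q) δ, DifferentiableOn ℂ (fun ζ => H ζ ω) (ball q δ))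
    (h2 : ∀ ζ ∈ ball q δ, DifferentiableOn ℂ (fun ω => H ζ ω) (ball (cj q) δ))
    (hM : ∀ ζ ∈ ball q δ, ∀ ω ∈ ball (cj q) δ, ‖H ζ ω‖ ≤ M)
    (h0 : ∀ ζ ∈ ball q δ, H ζ (cj ζ) = 0) :
    ∀ ζ ∈ ball q (δ / 4), ∀ ω ∈ ball (cj q) (δ / 4), H ζ ω = 0 := by
  intro ζ hζ ω hω
  set x := ζ - q with hx
  set y := ω - cj q with hy
  have nx : ‖x‖ < δ / 4 := by simpa [dist_eq_norm] using hζ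
  have ny : ‖y‖ < δ / 4 := by simpa [dist_eq_norm] using hω
  set α := (1 / 2 : ℂ) • (x + cj y) with hα
  set β := (-Complex.I / 2 : ℂ) • (x - cj y) with hβ
  have nα : ‖α‖ < δ / 4 := by
    rw [hα, norm_smul]
    have := norm_add_le x (cj y)
    rw [norm_cj] at this
    norm_num
    linarith
  have nβ : ‖β‖ < δ / 4 := by
    rw [hβ, norm_smul]
    have := norm_sub_le x (cj y)
    rw [norm_cj] at this
    norm_num
    linarith
  set a : ℂ → EuclideanSpace ℂ (Fin n) := fun s => q + α + s • β with ha
  set b : ℂ → EuclideanSpace ℂ (Fin n) := fun s => cj q + cj α + s • cj β with hb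
  have had : Differentiable ℂ a := by fun_prop
  have hbd : Differentiable ℂ b := by fun_prop
  have hamem : ∀ s ∈ ball (0:ℂ) 2, a s ∈ ball q δ := by
    intro s hs
    rw [mem_ball_zero_iff] at hs
    rw [mem_ball, dist_eq_norm]
    have : a s - q = α + s • β := by simp [ha, add_assoc]
    rw [this]
    have h3 := norm_add_le α (s • β)
    rw [norm_smul s] at h3
    nlinarith [norm_nonneg β, norm_nonneg s]
  have hbmem : ∀ s ∈ ball (0:ℂ) 2, b s ∈ ball (cj q) δ := by
    intro s hs
    rw [mem_ball_zero_iff] at hs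
    rw [mem_ball, dist_eq_norm]
    have : b s - cj q = cj α + s • cj β := by simp [hb, add_assoc]
    rw [this]
    have h3 := norm_add_le (cj α) (s • cj β)
    rw [norm_smul s, norm_cj, norm_cj] at h3
    nlinarith [norm_nonneg β, norm_nonneg s]
  have hfd : DifferentiableOn ℂ (fun τ => H (a τ) (b τ)) (ball 0 2) := by
    intro τ hτ
    obtain ⟨ρ, hρ, hsub⟩ := Metric.isOpen_iff.1 isOpen_ball τ hτ
    refine (osgood_diag (M := M) (g := fun s t => H (a s) (b t)) hρ ?_ ?_ ?_).differentiableWithinAt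
    · intro t ht
      exact (h1 _ (hbmem t (hsub ht))).comp had.differentiableOn (fun s hs => hamem s (hsub hs))
    · intro s hs
      exact (h2 _ (hamem s (hsub hs))).comp hbd.differentiableOn (fun t ht => hbmem t (hsub ht))
    · intro s hs t ht
      exact hM _ (hamem s (hsub hs)) _ (hbmem t (hsub ht))
  have hreal : ∀ s : ℝ, |s| < 2 → H (a s) (b s) = 0 := by
    intro s hs
    have : b s = cj (a s) := by
      simp only [ha, hb, map_add, cj_smul]; simp
    rw [this]
    exact h0 _ (hamem _ (by simpa using hs))
  have hfreq : ∃ᶠ z in 𝓝[≠] (0:ℂ), H (a z) (b z) = 0 := by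
    have ht : Tendsto (fun s : ℝ => (s : ℂ)) (𝓝[≠] 0) (𝓝[≠] 0) := by
      refine tendsto_nhdsWithin_iff.2 ⟨?_, ?_⟩
      · have := Complex.continuous_ofReal.tendsto 0
        exact (by simpa using this : Tendsto (fun s : ℝ => (s : ℂ)) (𝓝 0) (𝓝 0)).mono_left nhdsWithin_le_nhds
      · filter_upwards [self_mem_nhdsWithin] with s hs
        simpa using hs
    refine ht.frequently (Eventually.frequently ?_)
    have : ∀ᶠ s : ℝ in 𝓝 0, |s| < 2 := by
      have := ball_mem_nhds (0:ℝ) (by norm_num : (0:ℝ) < 2)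
      filter_upwards [this] with s hs
      simpa using hs
    filter_upwards [nhdsWithin_le_nhds this] with s hs
    exact hreal s hs
  have := (hfd.analyticOnNhd isOpen_ball).eqOn_zero_of_preconnected_of_frequently_eq_zero
    (convex_ball _ _).isPreconnected (mem_ball_self (by norm_num)) hfreq
    (show Complex.I ∈ ball (0:ℂ) 2 by simp)
  have e1 : a Complex.I = ζ := by
    have : α + Complex.I • β = x := by
      rw [hα, hβ, smul_smul]
      have : Complex.I * (-Complex.I / 2) = 1 / 2 := by
        linear_combination (-1/2) * Complex.I_mul_I
      rw [this]
      module
    simp only [ha, add_assoc, this, hx]; abel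
  have e2 : b Complex.I = ω := by
    have : cj α + Complex.I • cj β = y := by
      rw [hα, hβ, cj_smul, cj_smul, smul_smul]
      have h4 : Complex.I * conj (-Complex.I / 2) = -1 / 2 := by
        rw [map_div₀, map_neg, Complex.conj_I, Complex.conj_ofNat]
        linear_combination (1/2) * Complex.I_mul_I
      have h5 : conj (1 / 2 : ℂ) = 1 / 2 := by
        rw [map_div₀, map_one, Complex.conj_ofNat]
      rw [h4, h5]
      simp only [map_add, map_sub, cj_cj]
      module
    simp only [hb, add_assoc, this, hy]; abel
  simpa [e1, e2] using this

lemma unique_polar {n : ℕ} {H : EuclideanSpace ℂ (Fin n) → EuclideanSpace ℂ (Fin n) → ℂ}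
    {r : ℝ} (hr : 0 < r)
    (h1 : ∀ ω ∈ ball 0 r, DifferentiableOn ℂ (fun ζ => H ζ ω) (ball 0 r))
    (h2 : ∀ ζ ∈ ball 0 r, DifferentiableOn ℂ (fun ω => H ζ ω) (ball 0 r))
    (h0 : ∀ ζ ∈ ball 0 r, H ζ (cj ζ) = 0) :
    ∀ ζ ∈ ball 0 r, ∀ ω ∈ ball 0 r, H ζ ω = 0 := by
  have hsub : closedBall (0 : EuclideanSpace ℂ (Fin n)) (r / 2) ⊆ ball 0 r :=
    closedBall_subset_ball (by linarith)
  set C : ℕ → Set (EuclideanSpace ℂ (Fin n)) := fun M =>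
    (⋂ ζ ∈ closedBall (0 : EuclideanSpace ℂ (Fin n)) (r / 2),
      (closedBall (0 : EuclideanSpace ℂ (Fin n)) (r / 2) ∩ (fun ω => H ζ ω) ⁻¹' closedBall 0 M))
      ∪ (ball 0 (r / 2))ᶜ with hC
  have hCc : ∀ M, IsClosed (C M) := by
    intro M
    refine IsClosed.union ?_ isOpen_ball.isClosed_compl
    refine isClosed_biInter fun ζ hζ => ?_
    exact ((h2 ζ (hsub hζ)).continuousOn.mono hsub).preimage_isClosed_of_isClosed
      isClosed_closedBall isClosed_closedBall
  have hCu : ⋃ M, C M = univ := by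
    refine eq_univ_of_forall fun ω => ?_
    by_cases hω : ω ∈ ball 0 (r / 2)
    · have hω' := ball_subset_closedBall hω
      have hcont := (h1 ω (hsub hω')).continuousOn.mono hsub
      obtain ⟨K, hK⟩ := (isCompact_closedBall _ _).exists_bound_of_continuousOn hcont
      obtain ⟨M, hM⟩ := exists_nat_ge K
      refine mem_iUnion.2 ⟨M, Or.inl ?_⟩
      refine mem_iInter₂.2 fun ζ hζ => ⟨hω', ?_⟩
      simpa using (hK ζ hζ).trans hM
    · exact mem_iUnion.2 ⟨0, Or.inr hω⟩
  obtain ⟨ω0, hω0, hω0'⟩ := (dense_iUnion_interior_of_closed hCc hCu).exists_mem_open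
    (isOpen_ball (x := (0 : EuclideanSpace ℂ (Fin n))) (ε := r / 2))
    ⟨0, mem_ball_self (by linarith)⟩
  obtain ⟨M, hM⟩ := mem_iUnion.1 hω0
  obtain ⟨δ, hδ, hδsub⟩ := Metric.isOpen_iff.1 (isOpen_interior.inter isOpen_ball) ω0 ⟨hM, hω0'⟩
  set q := cj ω0 with hq
  have hqω : cj q = ω0 := by simp [hq]
  have hbω : ball ω0 δ ⊆ ball 0 (r / 2) := fun ω hω => (hδsub hω).2
  have hbq : ball q δ ⊆ ball 0 (r / 2) := by
    intro ζ hζ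
    have : cj ζ ∈ ball ω0 δ := by
      rw [mem_ball, dist_eq_norm, ← hqω, ← map_sub, norm_cj, ← dist_eq_norm]; exact hζ
    have := hbω this
    simpa using this
  have hbr : ball (0 : EuclideanSpace ℂ (Fin n)) (r / 2) ⊆ ball 0 r := ball_subset_ball (by linarith)
  have hz := line_zero (H := H) (q := q) (δ := δ) (M := M)
    (fun ω hω => (h1 ω (hbr (hbω (hqω ▸ hω)))).mono (hbq.trans hbr))
    (fun ζ hζ => (h2 ζ (hbr (hbq hζ))).mono (by rw [hqω]; exact hbω.trans hbr))
    (fun ζ hζ ω hω => by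
      rw [hqω] at hω
      rcases interior_subset (hδsub hω).1 with h | h
      · simpa using (mem_iInter₂.1 h ζ (ball_subset_closedBall (hbq hζ))).2
      · exact absurd (hbω hω) h)
    (fun ζ hζ => h0 ζ (hbr (hbq hζ)))
  rw [hqω] at hz
  have hz1 : ∀ ω ∈ ball ω0 (δ / 4), ∀ ζ ∈ ball 0 r, H ζ ω = 0 := by
    intro ω hω
    have hωr : ω ∈ ball (0 : EuclideanSpace ℂ (Fin n)) r :=
      hbr (hbω (ball_subset_ball (by linarith) hω))
    refine zero_on_convex isOpen_ball (convex_ball _ _) (h1 ω hωr) (hbr (hbq (mem_ball_self hδ))) ?_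
    filter_upwards [ball_mem_nhds q (by linarith : 0 < δ / 4)] with ζ hζ
    exact hz ζ hζ ω hω
  intro ζ hζ
  refine zero_on_convex isOpen_ball (convex_ball _ _) (h2 ζ hζ) (hbr hω0') ?_
  filter_upwards [ball_mem_nhds ω0 (by linarith : 0 < δ / 4)] with ω hω
  exact hz1 ω hω ζ hζ

lemma complexify {ι E E' : Type*} [Fintype ι] [NormedAddCommGroup E] [NormedSpace ℝ E]
    [NormedAddCommGroup E'] [NormedSpace ℂ E'] (b : ι → E) (X : ι → E' →L[ℂ] ℂ) (ℓ : E → E')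
    (hℓ : Tendsto ℓ (𝓝 0) (𝓝 0)) (lam : ι → E → ℝ) (hb : ∀ h, ∑ i, lam i h • b i = h)
    (hX : ∀ i h, X i (ℓ h) = (lam i h : ℂ)) {f : E → ℝ} {x : E} (hf : AnalyticAt ℝ f x) :
    ∃ G : E' → ℂ, AnalyticAt ℂ G 0 ∧ ∀ᶠ h in 𝓝 0, G (ℓ h) = (f (x + h) : ℂ) := by
  classical
  obtain ⟨p, R, hp⟩ := hf
  set C : ℝ := 1 + ∑ i, ‖X i‖ with hC
  set D : ℝ := 1 + ∑ i, ‖b i‖ with hD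
  have hC0 : 0 < C := by positivity
  have hD0 : 0 < D := by positivity
  have hXC : ∀ i, ‖X i‖ ≤ C := fun i => by
    have := Finset.single_le_sum (f := fun i => ‖X i‖) (fun i _ => norm_nonneg _) (Finset.mem_univ i)
    linarith
  have hbD : ∀ i, ‖b i‖ ≤ D := fun i => by
    have := Finset.single_le_sum (f := fun i => ‖b i‖) (fun i _ => norm_nonneg _) (Finset.mem_univ i)
    linarith
  set q : FormalMultilinearSeries ℂ E' ℂ := fun k =>
    ∑ σ : Fin k → ι, ((p k (fun j => b (σ j)) : ℝ) : ℂ) •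
      (ContinuousMultilinearMap.mkPiAlgebra ℂ (Fin k) ℂ).compContinuousLinearMap
        (fun j => X (σ j)) with hq
  have hqa : ∀ k v, q k v = ∑ σ : Fin k → ι, ((p k (fun j => b (σ j)) : ℝ) : ℂ) *
      ∏ j, X (σ j) (v j) := by
    intro k v
    simp [hq]
  set N : ℝ := Fintype.card ι + 1 with hN
  have hN0 : 0 < N := by positivity
  have hqn : ∀ k, ‖q k‖ ≤ ‖p k‖ * (N * D * C) ^ k := by
    intro k
    refine ContinuousMultilinearMap.opNorm_le_bound (by positivity) fun v => ?_
    rw [hqa]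
    refine (norm_sum_le _ _).trans ?_
    have hterm : ∀ σ : Fin k → ι, ‖((p k (fun j => b (σ j)) : ℝ) : ℂ) * ∏ j, X (σ j) (v j)‖
        ≤ ‖p k‖ * D ^ k * (C ^ k * ∏ j, ‖v j‖) := by
      intro σ
      rw [norm_mul, Complex.norm_real, norm_prod]
      gcongr
      · refine ((p k).le_opNorm _).trans ?_
        gcongr
        calc ∏ j, ‖b (σ j)‖ ≤ ∏ j : Fin k, D :=
              Finset.prod_le_prod (fun _ _ => norm_nonneg _) (fun j _ => hbD _)
          _ = D ^ k := by simp
      · calc ∏ j, ‖X (σ j) (v j)‖ ≤ ∏ j, (C * ‖v j‖) :=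
              Finset.prod_le_prod (fun _ _ => norm_nonneg _)
                (fun j _ => ((X (σ j)).le_opNorm _).trans (by gcongr; exact hXC _))
          _ = _ := by rw [Finset.prod_mul_distrib]; simp
    refine (Finset.sum_le_sum fun σ _ => hterm σ).trans ?_
    rw [Finset.sum_const, Finset.card_univ, Fintype.card_fun, Fintype.card_fin, nsmul_eq_mul]
    push_cast
    have : (Fintype.card ι : ℝ) ^ k ≤ N ^ k := by gcongr; linarith
    calc _ ≤ N ^ k * (‖p k‖ * D ^ k * (C ^ k * ∏ j, ‖v j‖)) := by gcongr
      _ = _ := by rw [mul_pow, mul_pow]; ring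
  have hrad : 0 < q.radius := by
    have hpr : 0 < p.radius := hp.r_pos.trans_le hp.r_le
    obtain ⟨ρ, hρ0, hρ⟩ := ENNReal.lt_iff_exists_nnreal_btwn.1 hpr
    obtain ⟨K, hK0, hK⟩ := p.norm_mul_pow_le_of_lt_radius hρ
    have hρ0' : (0:ℝ) < ρ := by exact_mod_cast hρ0
    set s : NNReal := ⟨(ρ : ℝ) / (N * D * C), by positivity⟩ with hs
    have hsv : (s : ℝ) = (ρ : ℝ) / (N * D * C) := rfl
    have hs0 : 0 < s := by
      have : (0:ℝ) < s := by rw [hsv]; positivity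
      exact_mod_cast this
    have : (s : ENNReal) ≤ q.radius := by
      refine q.le_radius_of_bound K fun k => ?_
      calc ‖q k‖ * (s:ℝ) ^ k ≤ ‖p k‖ * (N * D * C) ^ k * (s:ℝ) ^ k := by gcongr; exact hqn k
        _ = ‖p k‖ * (ρ:ℝ) ^ k := by
            rw [mul_assoc, ← mul_pow]
            congr 2
            rw [hsv]
            field_simp
        _ ≤ K := hK k
    exact lt_of_lt_of_le (by exact_mod_cast hs0) this
  have hG := q.hasFPowerSeriesOnBall hrad
  refine ⟨q.sum, hG.analyticAt, ?_⟩
  have e1 := hℓ.eventually (Metric.eball_mem_nhds 0 hrad)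
  filter_upwards [e1, Metric.eball_mem_nhds 0 hp.r_pos] with h h1 h2
  have s1 := hG.hasSum h1
  have s2 := hp.hasSum h2
  rw [zero_add] at s1
  have s3 := (Complex.hasSum_ofReal).2 s2
  refine s1.unique ?_
  suffices hfun : (fun k => q k fun _ => ℓ h) = fun k => ((p k fun _ => h : ℝ) : ℂ) by
    rw [hfun]; exact s3
  funext k
  rw [hqa]
  have hh : (fun _ : Fin k => h) = fun _ : Fin k => ∑ i, lam i h • b i := by
    funext _; exact (hb h).symm
  rw [hh, ContinuousMultilinearMap.map_sum]
  push_cast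
  refine Finset.sum_congr rfl fun σ _ => ?_
  rw [ContinuousMultilinearMap.map_smul_univ]
  simp only [hX, smul_eq_mul]
  push_cast
  ring

abbrev EE (n : ℕ) := EuclideanSpace ℂ (Fin n)

lemma complexify_at {n : ℕ} {f : EE n → ℝ} {p : EE n} (hf : AnalyticAt ℝ f p) :
    ∃ G : EE n × EE n → ℂ, AnalyticAt ℂ G 0 ∧ ∀ᶠ h in 𝓝 0, G (h, cj h) = (f (p + h) : ℂ) := by
  set pr : Fin n → EE n →L[ℂ] ℂ := fun j => EuclideanSpace.proj j
  refine complexify (ι := Fin n × Bool) (E' := EE n × EE n)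
    (fun i => if i.2 then ej i.1 else Complex.I • ej i.1)
    (fun i => if i.2 then (1/2 : ℂ) • ((pr i.1).comp (ContinuousLinearMap.fst ℂ _ _)
          + (pr i.1).comp (ContinuousLinearMap.snd ℂ _ _))
        else (-Complex.I/2 : ℂ) • ((pr i.1).comp (ContinuousLinearMap.fst ℂ _ _)
          - (pr i.1).comp (ContinuousLinearMap.snd ℂ _ _)))
    (fun h => (h, cj h)) ?_ (fun i h => if i.2 then (h i.1).re else (h i.1).im) ?_ ?_ hf
  · have : Continuous (fun h : EE n => (h, cj h)) := by fun_prop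
    have h2 := this.tendsto 0
    rw [map_zero] at h2
    exact h2
  · intro h
    ext j
    simp only [Fintype.sum_prod_type, Fintype.sum_bool]
    simp only [PiLp.add_apply, WithLp.ofLp_sum, Finset.sum_apply, ej]
    simp [Finset.sum_add_distrib]
  · rintro ⟨j, t⟩ h
    cases t
    · simp [pr, Complex.ext_iff]
      ring
    · simp [pr, Complex.ext_iff]
      ring

lemma conj_holo {n : ℕ} {g : EE n → ℂ} {a x : EE n} (hg : DifferentiableAt ℂ g (a + cj x)) :
    DifferentiableAt ℂ (fun ω => conj (g (a + cj ω))) x := by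
  set L := fderiv ℂ g (a + cj x) with hL
  set L' : EE n →L[ℂ] ℂ := LinearMap.toContinuousLinearMap
    { toFun := fun v => conj (L (cj v))
      map_add' := fun v w => by simp
      map_smul' := fun c v => by simp [cj_smul] } with hL'
  have h1 : HasFDerivAt g (L.restrictScalars ℝ) (a + cj x) := hg.hasFDerivAt.restrictScalars ℝ
  have h2 : HasFDerivAt (fun ω : EE n => a + cj ω) cj x := cj.hasFDerivAt.const_add a
  have h3 := h1.comp x h2
  have h4 := (Complex.conjCLE.toContinuousLinearMap.hasFDerivAt (x := g (a + cj x))).comp x h3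
  have h5 : HasFDerivAt (fun ω => conj (g (a + cj ω))) L' x := by
    refine hasFDerivAt_of_restrictScalars ℝ h4 ?_
    ext v
    rfl
  exact h5.differentiableAt

lemma re_le_of_line {E' : Type*} [NormedAddCommGroup E'] [NormedSpace ℂ E'] {f : E' → ℂ}
    {x d : E'} (hf : ∀ t : ℝ, t ∈ Icc (0:ℝ) 1 → DifferentiableAt ℂ f (x + (t:ℂ) • d))
    (hpos : ∀ t : ℝ, t ∈ Icc (0:ℝ) 1 → 0 ≤ (fderiv ℂ f (x + (t:ℂ) • d) d).re) :
    (f x).re ≤ (f (x + d)).re := by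
  have hd : ∀ t : ℝ, t ∈ Icc (0:ℝ) 1 → HasDerivAt (fun t : ℝ => (f (x + (t:ℂ) • d)).re)
      (fderiv ℂ f (x + (t:ℂ) • d) d).re t := by
    intro t ht
    have hp : HasDerivAt (fun s : ℂ => x + s • d) d (t : ℂ) := by
      have := ((hasDerivAt_id (t:ℂ)).smul_const d).const_add x
      simpa using this
    exact ((hf t ht).hasFDerivAt.comp_hasDerivAt (t:ℂ) hp).real_of_complex
  have hm : MonotoneOn (fun t : ℝ => (f (x + (t:ℂ) • d)).re) (Icc 0 1) := by
    refine monotoneOn_of_deriv_nonneg (convex_Icc 0 1)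
      (fun t ht => (hd t ht).continuousAt.continuousWithinAt)
      (fun t ht => (hd t (interior_subset ht)).differentiableAt.differentiableWithinAt)
      (fun t ht => ?_)
    rw [(hd t (interior_subset ht)).deriv]
    exact hpos t (interior_subset ht)
  have := hm (left_mem_Icc.2 zero_le_one) (right_mem_Icc.2 zero_le_one) zero_le_one
  simpa using this

/-- The totally real embedding `h ↦ (h, conj h)`. -/
def ell {n : ℕ} : EE n →L[ℝ] EE n × EE n := (ContinuousLinearMap.id ℝ (EE n)).prod cj

lemma D2_eq {n : ℕ} {φ : EE n → ℝ} (hφ : AnalyticOnNhd ℝ φ univ) {p : EE n} {G : EE n × EE n → ℂ}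
    (hG : AnalyticAt ℂ G 0) (hGφ : ∀ᶠ h in 𝓝 0, G (h, cj h) = (φ (p + h) : ℂ)) (h k : EE n) :
    (D2 φ p h k : ℂ) = fderiv ℂ (fderiv ℂ G) 0 (h, cj h) (k, cj k) := by
  have hsub : ∀ z : EE n, HasFDerivAt (fun z : EE n => ell (z - p)) ell z := fun z => by
    have := (ell (n := n)).hasFDerivAt (x := z - p)
    exact this.comp z ((hasFDerivAt_id z).sub_const p)
  have htend : Tendsto (fun z : EE n => z - p) (𝓝 p) (𝓝 0) := by
    have : Continuous (fun z : EE n => z - p) := by fun_prop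
    simpa using this.tendsto p
  have htend' : Tendsto (fun z : EE n => ell (z - p)) (𝓝 p) (𝓝 0) := by
    have := (hsub p).continuousAt.tendsto
    simpa using this
  have e1 : ∀ᶠ z in 𝓝 p, (φ z : ℂ) = G (ell (z - p)) := by
    filter_upwards [htend.eventually hGφ] with z hz
    have : p + (z - p) = z := by abel
    rw [this] at hz
    exact hz.symm
  have e2 : ∀ᶠ z in 𝓝 p, ((fderiv ℝ φ z k : ℝ) : ℂ) = fderiv ℂ G (ell (z - p)) (ell k) := by
    filter_upwards [e1.eventually_nhds, htend'.eventually hG.eventually_analyticAt] with z hz hGz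
    have d1 : HasFDerivAt (fun z => (φ z : ℂ)) (Complex.ofRealCLM.comp (fderiv ℝ φ z)) z :=
      Complex.ofRealCLM.hasFDerivAt.comp z (hφ z (mem_univ z)).differentiableAt.hasFDerivAt
    have d2 : HasFDerivAt (fun z => G (ell (z - p)))
        (((fderiv ℂ G (ell (z - p))).restrictScalars ℝ).comp ell) z :=
      (hGz.differentiableAt.hasFDerivAt.restrictScalars ℝ).comp z (hsub z)
    have := d1.unique (d2.congr_of_eventuallyEq hz)
    have := congrArg (fun L => L k) this
    simpa using this
  have d1 : HasFDerivAt (fun z => ((fderiv ℝ φ z k : ℝ) : ℂ))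
      (Complex.ofRealCLM.comp ((fderiv ℝ (fderiv ℝ φ) p).flip k)) p := by
    have := ((hφ p (mem_univ p)).fderiv).differentiableAt.hasFDerivAt
    have := this.clm_apply (hasFDerivAt_const k p)
    have := Complex.ofRealCLM.hasFDerivAt.comp p this
    refine this.congr_fderiv ?_
    ext v
    simp
  have hG0 : HasFDerivAt (fderiv ℂ G) (fderiv ℂ (fderiv ℂ G) 0) (ell (p - p)) := by
    have := hG.fderiv.differentiableAt.hasFDerivAt
    simpa using this
  have d2 : HasFDerivAt (fun z => fderiv ℂ G (ell (z - p)) (ell k))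
      ((((fderiv ℂ (fderiv ℂ G) 0).flip (ell k)).restrictScalars ℝ).comp ell) p := by
    have hh : HasFDerivAt (fun y => fderiv ℂ G y (ell k))
        ((fderiv ℂ (fderiv ℂ G) 0).flip (ell k)) (ell (p - p)) := by
      refine (hG0.clm_apply (hasFDerivAt_const (ell k) (ell (p - p)))).congr_fderiv ?_
      ext v <;> simp
    exact (hh.restrictScalars ℝ).comp p (hsub p)
  have := d1.unique (d2.congr_of_eventuallyEq e2)
  have := congrArg (fun L => L h) this
  simpa [D2, ell] using this

lemma cj_ej {n : ℕ} (j : Fin n) : cj (ej j) = ej j := by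
  ext i
  simp only [cj_apply, ej, PiLp.single_apply]
  split_ifs <;> simp

lemma sum_ej {n : ℕ} (a : EE n) : ∑ j, a j • ej j = a := by
  ext i
  simp [ej, Pi.single_apply]

lemma levi_eq {n : ℕ} {φ : EE n → ℝ} {p : EE n} {B : EE n × EE n →L[ℂ] EE n × EE n →L[ℂ] ℂ}
    (hB : ∀ h k, (D2 φ p h k : ℂ) = B (h, cj h) (k, cj k)) (a : EE n) :
    ∑ j, ∑ k, cHess φ p j k * a j * conj (a k) = B (a, 0) (0, cj a) := by
  have hc : ∀ j k, cHess φ p j k = B (ej j, 0) (0, ej k) := by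
    intro j k
    have s1 : ∀ i : Fin n, ((ej i, cj (ej i)) : EE n × EE n) = (ej i, 0) + (0, ej i) := by
      intro i; simp [cj_ej]
    have s2 : ∀ i : Fin n, ((Complex.I • ej i, cj (Complex.I • ej i)) : EE n × EE n)
        = Complex.I • (ej i, 0) - Complex.I • (0, ej i) := by
      intro i; simp [cj_ej, cj_smul]
    simp only [cHess, Complex.ofReal_add, Complex.ofReal_sub, hB, s1, s2]
    simp only [map_add, map_sub, map_smul, add_apply,
      sub_apply, smul_apply, smul_eq_mul]
    ring_nf
    simp only [Complex.I_sq]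
    ring
  have s1 : ((a, 0) : EE n × EE n) = ∑ j, a j • (ej j, (0 : EE n)) := by
    ext1
    · simp [Prod.fst_sum, sum_ej]
    · simp [Prod.snd_sum]
  have s2 : ((0, cj a) : EE n × EE n) = ∑ j, conj (a j) • ((0 : EE n), ej j) := by
    ext1
    · simp [Prod.fst_sum]
    · have := sum_ej (cj a)
      simp only [cj_apply] at this
      simp [Prod.snd_sum, this]
  rw [s1, s2]
  simp only [map_sum, map_smul, sum_apply, smul_apply,
    smul_eq_mul, hc, Finset.mul_sum]
  rw [Finset.sum_comm]
  refine Finset.sum_congr rfl fun j _ => Finset.sum_congr rfl fun k _ => ?_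
  ring

lemma local_ineq {n : ℕ} {φ : EE n → ℝ} (hφ : AnalyticOnNhd ℝ φ univ) (hpsh : StronglyPsh φ)
    {W : Set (EE n × EE n)} {F : EE n × EE n → ℂ} (hW : IsOpen W) (hWd : ∀ z, (z, z) ∈ W)
    (hF : IsPolarization φ W F) (p : EE n) :
    ∀ᶠ x in 𝓝 (p, p), 2 * (F x).re ≤ φ x.1 + φ x.2 := by
  obtain ⟨G, hG, hGφ⟩ := complexify_at (hφ p (mem_univ p))
  obtain ⟨c, hc, hlevi⟩ := hpsh
  set B := fderiv ℂ (fderiv ℂ G) 0 with hBdef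
  have hBpos : ∀ a, c * ‖a‖ ^ 2 ≤ (B (a, 0) (0, cj a)).re := by
    intro a
    rw [← levi_eq (D2_eq hφ hG hGφ) a]
    exact hlevi p a
  have ev1 := hG.eventually_analyticAt
  have ev2 : ∀ᶠ x in 𝓝 0, ‖fderiv ℂ (fderiv ℂ G) x - B‖ < c := by
    have := hG.fderiv.fderiv.continuousAt
    have := Metric.continuousAt_iff'.1 this c hc
    simpa [dist_eq_norm] using this
  obtain ⟨r1, hr1, hb1⟩ := Metric.eventually_nhds_iff_ball.1 (ev1.and ev2)
  obtain ⟨r2, hr2, hb2⟩ := Metric.eventually_nhds_iff_ball.1 hGφ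
  obtain ⟨r3, hr3, hb3⟩ := Metric.isOpen_iff.1 hW (p, p) (hWd p)
  set r := min r1 (min r2 r3) with hr
  have hr0 : 0 < r := by positivity
  have hrr1 : r ≤ r1 := min_le_left _ _
  have hrr2 : r ≤ r2 := (min_le_right _ _).trans (min_le_left _ _)
  have hrr3 : r ≤ r3 := (min_le_right _ _).trans (min_le_right _ _)
  have hGa : ∀ ζ ∈ ball (0 : EE n) r, ∀ ω ∈ ball (0 : EE n) r, AnalyticAt ℂ G (ζ, ω) ∧
      ‖fderiv ℂ (fderiv ℂ G) (ζ, ω) - B‖ < c := by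
    intro ζ hζ ω hω
    apply hb1
    rw [mem_ball_zero_iff] at *
    exact (max_lt hζ hω).trans_le hrr1
  have hGd : ∀ ζ ∈ ball (0 : EE n) r, G (ζ, cj ζ) = (φ (p + ζ) : ℂ) := fun ζ hζ =>
    hb2 ζ (ball_subset_ball hrr2 hζ)
  have hWr : ∀ ζ ∈ ball (0 : EE n) r, ∀ ω ∈ ball (0 : EE n) r, (p + ζ, p + ω) ∈ W := by
    intro ζ hζ ω hω
    apply hb3
    rw [mem_ball_zero_iff] at *
    rw [mem_ball, dist_eq_norm]
    have : ((p + ζ, p + ω) : EE n × EE n) - (p, p) = (ζ, ω) := by simp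
    rw [this]
    exact (max_lt hζ hω).trans_le hrr3
  have hcjb : ∀ ζ ∈ ball (0 : EE n) r, cj ζ ∈ ball (0 : EE n) r := by
    intro ζ hζ; simpa using hζ
  obtain ⟨hF1, hF2, hF3⟩ := hF
  have hG1 : ∀ ω ∈ ball (0 : EE n) r, ∀ ζ ∈ ball (0 : EE n) r,
      DifferentiableAt ℂ (fun ζ => G (ζ, ω)) ζ := by
    intro ω hω ζ hζ
    have := (hGa ζ hζ ω hω).1.differentiableAt
    exact DifferentiableAt.comp (g := G) (f := fun ζ => (ζ, ω)) ζ this (by fun_prop)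
  have hG2 : ∀ ζ ∈ ball (0 : EE n) r, ∀ ω ∈ ball (0 : EE n) r,
      DifferentiableAt ℂ (fun ω => G (ζ, ω)) ω := by
    intro ζ hζ ω hω
    have := (hGa ζ hζ ω hω).1.differentiableAt
    exact DifferentiableAt.comp (g := G) (f := fun ω => (ζ, ω)) ω this (by fun_prop)
  have hFG : ∀ ζ ∈ ball (0 : EE n) r, ∀ ω ∈ ball (0 : EE n) r,
      F (p + ζ, p + cj ω) - G (ζ, ω) = 0 := by
    refine unique_polar (H := fun ζ ω => F (p + ζ, p + cj ω) - G (ζ, ω)) hr0 ?_ ?_ ?_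
    · intro ω hω ζ hζ
      refine (DifferentiableAt.sub ?_ (hG1 ω hω ζ hζ)).differentiableWithinAt
      have hmem := hWr ζ hζ _ (hcjb ω hω)
      have ho : IsOpen {z | (z, p + cj ω) ∈ W} := hW.preimage (by fun_prop)
      have := (hF1 (p + cj ω)).differentiableAt (ho.mem_nhds hmem)
      exact DifferentiableAt.comp (g := fun z => F (z, p + cj ω)) (f := fun ζ => p + ζ) ζ this
        (by fun_prop)
    · intro ζ hζ ω hω
      refine (DifferentiableAt.sub ?_ (hG2 ζ hζ ω hω)).differentiableWithinAt
      have hmem := hWr ζ hζ _ (hcjb ω hω)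
      have ho : IsOpen {w | (p + ζ, w) ∈ W} := hW.preimage (by fun_prop)
      have := (hF2 (p + ζ)).differentiableAt (ho.mem_nhds hmem)
      simpa using conj_holo this
    · intro ζ hζ
      simp [hF3, hGd ζ hζ]
  have hsym : ∀ ζ ∈ ball (0 : EE n) r, ∀ ω ∈ ball (0 : EE n) r,
      G (ζ, ω) - conj (G (cj ω, cj ζ)) = 0 := by
    refine unique_polar (H := fun ζ ω => G (ζ, ω) - conj (G (cj ω, cj ζ))) hr0 ?_ ?_ ?_
    · intro ω hω ζ hζ
      refine (DifferentiableAt.sub (hG1 ω hω ζ hζ) ?_).differentiableWithinAt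
      have := hG2 (cj ω) (hcjb ω hω) (cj ζ) (hcjb ζ hζ)
      rw [← zero_add (cj ζ)] at this
      simpa using conj_holo this
    · intro ζ hζ ω hω
      refine (DifferentiableAt.sub (hG2 ζ hζ ω hω) ?_).differentiableWithinAt
      have := hG1 (cj ζ) (hcjb ζ hζ) (cj ω) (hcjb ω hω)
      rw [← zero_add (cj ω)] at this
      simpa using conj_holo this
    · intro ζ hζ
      simp [hGd ζ hζ]
  have hpos : ∀ ζ ∈ ball (0 : EE n) r, ∀ ω ∈ ball (0 : EE n) r, ∀ v : EE n,
      0 ≤ (fderiv ℂ (fderiv ℂ G) (ζ, ω) (v, 0) (0, cj v)).re := by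
    intro ζ hζ ω hω v
    have h1 := (hGa ζ hζ ω hω).2
    set T := fderiv ℂ (fderiv ℂ G) (ζ, ω) with hT
    have h2 := (T - B).le_opNorm₂ (v, 0) (0, cj v)
    have n1 : ‖((v, 0) : EE n × EE n)‖ = ‖v‖ := by simp
    have n2 : ‖((0, cj v) : EE n × EE n)‖ = ‖v‖ := by simp
    rw [n1, n2] at h2
    have h3 := (Complex.abs_re_le_norm ((T - B) (v, 0) (0, cj v))).trans h2
    have h4 : ((T - B) (v, 0) (0, cj v)).re
        = (T (v, 0) (0, cj v)).re - (B (v, 0) (0, cj v)).re := by simp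
    rw [h4] at h3
    have h5 := (abs_le.1 h3).1
    have h6 := hBpos v
    nlinarith [mul_nonneg (norm_nonneg v) (norm_nonneg v)]
  have hcv : ∀ a ∈ ball (0 : EE n) r, ∀ b ∈ ball (0 : EE n) r, ∀ t : ℝ, t ∈ Icc (0:ℝ) 1 →
      a + (t:ℂ) • (b - a) ∈ ball (0 : EE n) r := by
    intro a ha b hb t ht
    have := (convex_ball (0 : EE n) r).add_smul_sub_mem ha hb ht
    simpa using this
  have main : ∀ ζ ∈ ball (0 : EE n) r, ∀ η ∈ ball (0 : EE n) r,
      2 * (G (ζ, cj η)).re ≤ φ (p + ζ) + φ (p + η) := by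
    intro ζ hζ η hη
    set v := ζ - η with hv
    have hωt : ∀ t : ℝ, t ∈ Icc (0:ℝ) 1 → cj η + (t:ℂ) • cj v ∈ ball (0 : EE n) r := by
      intro t ht
      have := hcv (cj η) (hcjb η hη) (cj ζ) (hcjb ζ hζ) t ht
      rwa [← map_sub] at this
    have hy : ∀ t : ℝ, ((η, cj η) : EE n × EE n) + (t:ℂ) • (0, cj v)
        = (η, cj η + (t:ℂ) • cj v) := by
      intro t; simp
    have hyv : ∀ ω : EE n, ((η, ω) : EE n × EE n) + (v, 0) = (ζ, ω) := by
      intro ω; simp [hv]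
    have hd1 : ∀ t : ℝ, t ∈ Icc (0:ℝ) 1 → DifferentiableAt ℂ (fun y => G (y + (v, 0)))
        (η, cj η + (t:ℂ) • cj v) := by
      intro t ht
      rw [differentiableAt_comp_add_right, hyv]
      exact (hGa ζ hζ _ (hωt t ht)).1.differentiableAt
    have hd2 : ∀ t : ℝ, t ∈ Icc (0:ℝ) 1 → DifferentiableAt ℂ G
        (η, cj η + (t:ℂ) • cj v) := fun t ht => (hGa η hη _ (hωt t ht)).1.differentiableAt
    have key := re_le_of_line (f := fun y => G (y + (v, 0)) - G y) (x := (η, cj η)) (d := (0, cj v))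
      ?_ ?_
    · have i1 : ((η, cj η) : EE n × EE n) + (v, 0) = (ζ, cj η) := by simp [hv]
      have i2 : ((η, cj η) : EE n × EE n) + (0, cj v) = (η, cj ζ) := by simp [hv]
      have i3 : ((η, cj ζ) : EE n × EE n) + (v, 0) = (ζ, cj ζ) := by simp [hv]
      simp only [i1, i2, i3, Complex.sub_re] at key
      have j1 := congrArg Complex.re (hsym η hη (cj ζ) (hcjb ζ hζ))
      simp only [cj_cj, Complex.sub_re, Complex.conj_re, Complex.zero_re] at j1
      have j2 := congrArg Complex.re (hGd ζ hζ)
      have j3 := congrArg Complex.re (hGd η hη)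
      simp only [Complex.ofReal_re] at j2 j3
      linarith
    · intro t ht
      rw [hy]
      exact (hd1 t ht).sub (hd2 t ht)
    · intro t ht
      rw [hy, fderiv_fun_sub (hd1 t ht) (hd2 t ht), fderiv_comp_add_right, hyv, sub_apply,
        Complex.sub_re]
      have hs : ∀ s : ℝ, ((η, cj η + (t:ℂ) • cj v) : EE n × EE n) + (s:ℂ) • (v, 0)
          = (η + (s:ℂ) • v, cj η + (t:ℂ) • cj v) := by
        intro s; simp
      have hfd : ∀ s : ℝ, s ∈ Icc (0:ℝ) 1 → HasFDerivAt (fun y => fderiv ℂ G y (0, cj v))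
          ((fderiv ℂ (fderiv ℂ G) (η + (s:ℂ) • v, cj η + (t:ℂ) • cj v)).flip (0, cj v))
          (η + (s:ℂ) • v, cj η + (t:ℂ) • cj v) := by
        intro s hs'
        have hmem : η + (s:ℂ) • v ∈ ball (0 : EE n) r := hcv η hη ζ hζ s hs'
        have hA := (hGa _ hmem _ (hωt t ht)).1.fderiv.differentiableAt.hasFDerivAt
        refine (hA.clm_apply (hasFDerivAt_const _ _)).congr_fderiv ?_
        ext y <;> simp
      have key2 := re_le_of_line (f := fun y => fderiv ℂ G y (0, cj v))
        (x := (η, cj η + (t:ℂ) • cj v)) (d := (v, 0)) ?_ ?_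
      · simp only [hyv] at key2
        linarith
      · intro s hs'
        rw [hs]
        exact (hfd s hs').differentiableAt
      · intro s hs'
        rw [hs, (hfd s hs').fderiv]
        exact hpos _ (hcv η hη ζ hζ s hs') _ (hωt t ht) v
  filter_upwards [ball_mem_nhds (p, p) hr0] with x hx
  rw [mem_ball, dist_eq_norm] at hx
  have hx1 : x.1 - p ∈ ball (0 : EE n) r := by
    rw [mem_ball_zero_iff]; exact (norm_fst_le (x - (p, p))).trans_lt hx
  have hx2 : x.2 - p ∈ ball (0 : EE n) r := by
    rw [mem_ball_zero_iff]; exact (norm_snd_le (x - (p, p))).trans_lt hx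
  have hm := main _ hx1 _ hx2
  have hf := sub_eq_zero.1 (hFG _ hx1 _ (hcjb _ hx2))
  have a1 : p + (x.1 - p) = x.1 := by abel
  have a2 : p + (x.2 - p) = x.2 := by abel
  rw [cj_cj, a1, a2] at hf
  rw [a1, a2, ← hf] at hm
  exact hm

theorem legendre_phi_finite_and_fixed_point (n : ℕ) (hn : 1 ≤ n)
    (φ : EuclideanSpace ℂ (Fin n) → ℝ)
    (hφ : AnalyticOnNhd ℝ φ Set.univ) (hpsh : StronglyPsh φ)
    (W : Set (EuclideanSpace ℂ (Fin n) × EuclideanSpace ℂ (Fin n)))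
    (F : EuclideanSpace ℂ (Fin n) × EuclideanSpace ℂ (Fin n) → ℂ)
    (hW : IsOpen W) (hWdiag : ∀ z : EuclideanSpace ℂ (Fin n), (z, z) ∈ W)
    (hF : IsPolarization φ W F) :
    ∃ (V : Set (EuclideanSpace ℂ (Fin n) × EuclideanSpace ℂ (Fin n))) (ε : ℝ),
      IsOpen V ∧ (∀ z : EuclideanSpace ℂ (Fin n), (z, z) ∈ V) ∧ V ⊆ W ∧ 0 < ε ∧
      ∀ u : EuclideanSpace ℂ (Fin n) → ℝ, ContDiff ℝ 2 u → C2Close u φ ε →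
        (∀ w : EuclideanSpace ℂ (Fin n), ∃ r : ℝ, Leg F V u w = (r : EReal)) ∧
        ((∀ w : EuclideanSpace ℂ (Fin n), Leg F V u w = (u w : EReal)) ↔ u = φ) := by
  have hloc := local_ineq hφ hpsh hW hWdiag hF
  refine ⟨interior {x | 2 * (F x).re ≤ φ x.1 + φ x.2} ∩ W, 1, isOpen_interior.inter hW,
    fun z => ⟨mem_interior_iff_mem_nhds.2 (hloc z), hWdiag z⟩, inter_subset_right, one_pos, ?_⟩
  set V := interior {x | 2 * (F x).re ≤ φ x.1 + φ x.2} ∩ W with hV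
  have hVd : ∀ z, (z, z) ∈ V := fun z => ⟨mem_interior_iff_mem_nhds.2 (hloc z), hWdiag z⟩
  have hVi : ∀ z w, (z, w) ∈ V → 2 * (F (z, w)).re ≤ φ z + φ w := fun z w h => by
    have h2 : (z, w) ∈ {x : EuclideanSpace ℂ (Fin n) × EuclideanSpace ℂ (Fin n) |
      2 * (F x).re ≤ φ x.1 + φ x.2} := interior_subset h.1
    exact h2
  have hdiag : ∀ w, (F (w, w)).re = φ w := fun w => by rw [hF.2.2 w]; simp
  intro u hu hclose
  have hlow : ∀ w, ((2 * φ w - u w : ℝ) : EReal) ≤ Leg F V u w := by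
    intro w
    have := le_iSup₂ (f := fun z (_ : z ∈ {z | (z, w) ∈ V}) =>
      ((2 * (F (z, w)).re - u z : ℝ) : EReal)) w (hVd w)
    rw [hdiag] at this
    exact this
  have hup : ∀ w (K : ℝ), (∀ z, φ z - u z ≤ K) → Leg F V u w ≤ ((φ w + K : ℝ) : EReal) := by
    intro w K hK
    refine iSup₂_le fun z hz => ?_
    rw [EReal.coe_le_coe_iff]
    have := hVi z w hz
    have := hK z
    linarith
  refine ⟨fun w => ?_, fun h => ?_, fun h w => ?_⟩
  · have h1 := hlow w
    have h2 := hup w 1 (fun z => by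
      have h3 := hclose z
      have h4 := neg_abs_le (u z - φ z)
      have h5 := norm_nonneg (fderiv ℝ (fun x => u x - φ x) z)
      have h6 := norm_nonneg (fderiv ℝ (fderiv ℝ (fun x => u x - φ x)) z)
      linarith)
    refine ⟨(Leg F V u w).toReal, (EReal.coe_toReal ?_ ?_).symm⟩
    · exact ne_top_of_le_ne_top (EReal.coe_ne_top _) h2
    · exact ne_bot_of_le_ne_bot (EReal.coe_ne_bot _) h1
  · have hge : ∀ w, φ w ≤ u w := by
      intro w
      have := hlow w
      rw [h w, EReal.coe_le_coe_iff] at this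
      linarith
    funext w
    refine le_antisymm ?_ (hge w)
    have := hup w 0 (fun z => by have := hge z; linarith)
    rw [h w, EReal.coe_le_coe_iff] at this
    linarith
  · subst h
    refine le_antisymm ?_ ?_
    · simpa using hup w 0 (fun z => by simp)
    · have := hlow w
      rwa [two_mul, add_sub_cancel_right] at this
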